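/- Let N ∈ ℤ_{≥1} and let ϑ be the Riemann–Siegel theta branch. There is a constant C depending only on N such that for all real t ≠ 0, |ϑ(1/2 + it) − (t/2)·log(|t|/(2π)) + t/2 + sgn(t)·π/8 + Σ_{n=1}^{N−1} (−4)^{n−1}·B_{2n}(1/4)/((2n−1)·n·t^{2n−1})| ≤ C/|t|^{2N−1}, where log(|t|/(2π)) is the real logarithm (here ϑ(1/2+it) is real). -/

import Mathlib

open Complex Real MeasureTheory

noncomputable section

def chi (s : ℂ) : ℂ := (π : ℂ) ^ (s - 1/2) * Complex.Gamma ((1 - s)/2) / Complex.Gamma (s/2)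

def RSOmega : Set ℂ := {s : ℂ | s.im ≠ 0 ∨ (0 < s.re ∧ s.re < 1)}

def IsRSTheta (ϑ : ℂ → ℂ) : Prop :=
  DifferentiableOn ℂ ϑ RSOmega ∧ (∀ s ∈ RSOmega, Complex.exp (-2 * I * ϑ s) = chi s) ∧
    ϑ (1/2) = 0

def zetaSum (x : ℝ) (s : ℂ) : ℂ := ∑ n ∈ Finset.Icc 1 ⌊x⌋₊, (n : ℂ) ^ (-s)

def Upsilon (u τ : ℂ) : ℂ :=
  ∫ v : ℝ, Complex.exp (3 * (π:ℂ) * I / 4) *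
    (Complex.exp (-(π:ℂ) * I * τ * (1/2 + Complex.exp (3 * (π:ℂ) * I / 4) * v) ^ 2
        + 2 * (π:ℂ) * I * u * (1/2 + Complex.exp (3 * (π:ℂ) * I / 4) * v)) /
      (Complex.exp (2 * (π:ℂ) * I * (1/2 + Complex.exp (3 * (π:ℂ) * I / 4) * v)) - 1))

def G (u τ : ℂ) : ℂ :=
  τ ^ ((1:ℂ)/4) * Complex.exp (-(π:ℂ) * I * u ^ 2 / 2 + (π:ℂ) * I / 8) *
    Upsilon (τ ^ ((1:ℂ)/2) * u) τ

def Gderiv (k : ℕ) (u τ : ℂ) : ℂ := iteratedDeriv k (fun w => G w τ) u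

def hermiteH (n : ℕ) (x : ℂ) : ℂ :=
  (Nat.factorial n : ℂ) * ∑ j ∈ Finset.range (n / 2 + 1),
    (-1:ℂ) ^ j / ((Nat.factorial j : ℂ) * (Nat.factorial (n - 2*j) : ℂ)) * (2 * x) ^ (n - 2*j)

def obell (p : ℕ → ℂ) (i j : ℕ) : ℂ :=
  ∑ f ∈ (Finset.Nat.antidiagonalTuple j i).filter (fun f => ∀ l, 1 ≤ f l), ∏ l, p (f l)

def bernoulliPoly (n : ℕ) (x : ℂ) : ℂ := Polynomial.aeval x (Polynomial.bernoulli n)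

def fseq (σ : ℝ) (n : ℕ) : ℂ :=
  (bernoulliPoly (n+1) ((σ:ℂ)/2) + (-1:ℂ)^(n+1) * bernoulliPoly (n+1) ((1-(σ:ℂ))/2)) /
    (2*(n:ℂ)*((n:ℂ)+1))

def um (m : ℕ) (σ : ℝ) : ℂ :=
  (-2:ℂ)^m * ∑ k ∈ Finset.range (m+1), obell (fseq σ) m k / (Nat.factorial k : ℂ)

def seqA (j : ℕ) : ℂ := (-1:ℂ)^(j+1) / ((j:ℂ) + 2)

def seqB (j : ℕ) : ℂ := (-1:ℂ)^(j+1) / (j:ℂ)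

def dd (m r : ℕ) (σ : ℝ) : ℂ :=
  ∑ n ∈ Finset.Icc r m, (obell seqA n r / (Nat.factorial r : ℂ)) *
    ∑ k ∈ Finset.range (m - n + 1),
      (obell seqB (m - n) k / (Nat.factorial k : ℂ)) * ((σ:ℂ) - 1)^k

def qq (n ℓ : ℕ) (σ : ℝ) : ℂ :=
  ∑ m ∈ Finset.Icc (ℓ - n) (ℓ / 3), um m σ * dd (n - 2*m) (n + m - ℓ) σ

def PP (n k : ℕ) (x : ℂ) (σ : ℝ) : ℂ :=
  Complex.exp (3 * (π:ℂ) * I * (k:ℂ) / 4) * ∑ ℓ ∈ Finset.range (k/2 + 1),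
    (Nat.choose (3*n - 2*ℓ) (3*n - k) : ℂ) * (-1:ℂ)^(n + ℓ) * 2^(2*ℓ) / 2^k *
      qq n ℓ σ * hermiteH (k - 2*ℓ) (Complex.exp (-(π:ℂ) * I / 4) * x)

def IsAk (s : ℂ) (a : ℕ → ℂ) : Prop :=
  a 0 = 1 ∧ ∀ k : ℕ, ((k:ℂ) + 1) * (Real.sqrt s.im : ℂ) * a (k+1) =
    -((k:ℂ) + 1 - (s.re:ℂ)) * a k + I * (if 2 ≤ k then a (k-2) else 0)

def IsPsi (Ψ : ℂ → ℂ) : Prop :=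
  Differentiable ℂ Ψ ∧ ∀ u : ℂ, Complex.cos ((π:ℂ)*u) ≠ 0 →
    Ψ u = Complex.cos ((π:ℂ)*(u^2/2 - u - 1/8)) / Complex.cos ((π:ℂ)*u)

def wfun (s z : ℂ) : ℂ :=
  Complex.exp ((s - 1) * Complex.log (1 + z / (Real.sqrt s.im : ℂ))
    - I * (Real.sqrt s.im : ℂ) * z + I * z^2 / 2)

def rn (n : ℕ) (s z : ℂ) : ℂ :=
  wfun s z - ∑ k ∈ Finset.range n, (iteratedDeriv k (wfun s) 0 / (Nat.factorial k : ℂ)) * z^k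

def GammaOmega : Set ℂ := {s : ℂ | s.im ≠ 0 ∨ 0 < s.re}

def IsLogGamma (L : ℂ → ℂ) : Prop :=
  DifferentiableOn ℂ L GammaOmega ∧ (∀ s ∈ GammaOmega, Complex.exp (L s) = Complex.Gamma s) ∧
    L 1 = 0

def gseq (σ : ℝ) (n : ℕ) : ℂ := -(bernoulliPoly (n+1) (σ:ℂ)) / ((n:ℂ)*((n:ℂ)+1))

def gammam (m : ℕ) (σ : ℝ) : ℂ :=
  I^m * ∑ k ∈ Finset.range (m+1), obell (gseq σ) m k / (Nat.factorial k : ℂ)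


def kq (a : ℝ) (j : ℕ) (u : ℝ) : ℂ := ((bernoulliFun j (a - u) / (Nat.factorial j : ℝ) : ℝ) : ℂ)

lemma kq_deriv (a : ℝ) (j : ℕ) (u : ℝ) : HasDerivAt (kq a (j+1)) (-kq a j u) u := by
  unfold kq
  have h1 := (hasDerivAt_bernoulliFun (j+1) (a-u))
  have h2 : HasDerivAt (fun u : ℝ => a - u) (-1) u := by
    simpa using (hasDerivAt_id u).const_sub a
  have h3 := ((h1.comp u h2).div_const ((Nat.factorial (j+1) : ℝ))).ofReal_comp
  refine HasDerivAt.congr_deriv h3 ?_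
  rw [← Complex.ofReal_neg]
  congr 1
  have : (Nat.factorial j : ℝ) ≠ 0 := by positivity
  rw [Nat.factorial_succ]
  push_cast
  simp
  field_simp

lemma kq_cont (a : ℝ) (j : ℕ) : Continuous (kq a j) := by
  unfold kq
  have := continuous_bernoulliFun j
  fun_prop

def RR (a : ℝ) (f : ℕ → ℝ → ℂ) (j : ℕ) : ℂ :=
  (∫ u in (0:ℝ)..a, f j u * kq a j u) + ∫ u in a..(1:ℝ), f j u * kq a j (u - 1)

lemma RR_step (a : ℝ) (f : ℕ → ℝ → ℂ) (hf : ∀ j x, HasDerivAt (f j) (f (j+1) x) x) (j : ℕ) :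
    RR a f j = RR a f (j+1) - kq a (j+1) 0 * (f j 1 - f j 0) + if j = 0 then f 0 a else 0 := by
  have hc : ∀ j, Continuous (f j) := fun j =>
    continuous_iff_continuousAt.2 fun x => (hf j x).continuousAt
  have h1 := intervalIntegral.integral_mul_deriv_eq_deriv_mul (a := 0) (b := a)
    (u := f j) (v := kq a (j+1)) (u' := f (j+1)) (v' := fun u => - kq a j u)
    (fun x _ => hf j x) (fun x _ => kq_deriv a j x)
    ((hc _).intervalIntegrable _ _) ((kq_cont a j).neg.intervalIntegrable _ _)
  have h2 := intervalIntegral.integral_mul_deriv_eq_deriv_mul (a := a) (b := 1)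
    (u := f j) (v := fun u => kq a (j+1) (u-1)) (u' := f (j+1)) (v' := fun u => - kq a j (u-1))
    (fun x _ => hf j x) (fun x _ => by
      simpa using (kq_deriv a j (x-1)).comp_sub_const x 1)
    ((hc _).intervalIntegrable _ _)
    (((kq_cont a j).comp (by fun_prop : Continuous fun u : ℝ => u - 1)).neg.intervalIntegrable _ _)
  simp only [mul_neg, intervalIntegral.integral_neg] at h1 h2
  have e : kq a (j+1) (a-1) = kq a (j+1) a + if j = 0 then 1 else 0 := by
    unfold kq
    have := bernoulliFun_eval_one (j+1)
    simp only [sub_sub_cancel, sub_self, this]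
    split_ifs with h <;> simp_all
  simp only [sub_self] at h2
  unfold RR
  rw [e] at h2
  split_ifs at * with h
  · subst h
    linear_combination -h1 - h2
  · linear_combination -h1 - h2

lemma EM1 (a : ℝ) (f : ℕ → ℝ → ℂ) (hf : ∀ j x, HasDerivAt (f j) (f (j+1) x) x) (M : ℕ) :
    (∫ u in (0:ℝ)..1, f 0 u) = f 0 a - (∑ j ∈ Finset.range (M+1), kq a (j+1) 0 * (f j 1 - f j 0))
      + RR a f (M+1) := by
  have hc : ∀ j, Continuous (f j) := fun j =>
    continuous_iff_continuousAt.2 fun x => (hf j x).continuousAt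
  induction M with
  | zero =>
    have := RR_step a f hf 0
    have e : RR a f 0 = ∫ u in (0:ℝ)..1, f 0 u := by
      simp only [RR, kq, bernoulliFun_zero]
      simp only [Nat.factorial_zero, Nat.cast_one, div_one, Complex.ofReal_one, mul_one]
      exact intervalIntegral.integral_add_adjacent_intervals ((hc 0).intervalIntegrable _ _)
        ((hc 0).intervalIntegrable _ _)
    simp at this ⊢
    rw [← e, this]; ring
  | succ M ih =>
    rw [ih, RR_step a f hf (M+1), Finset.sum_range_succ _ (M+1)]
    simp; ring

lemma RR_bound (a : ℝ) (h0 : 0 ≤ a) (h1 : a ≤ 1) (j : ℕ) : ∃ K : ℝ, 0 ≤ K ∧ ∀ (f : ℕ → ℝ → ℂ),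
    Continuous (f j) → ‖RR a f j‖ ≤ K * ∫ u in (0:ℝ)..1, ‖f j u‖ := by
  obtain ⟨K, hK⟩ := (isCompact_Icc (a := (-1:ℝ)) (b := 1)).exists_bound_of_continuousOn
    (kq_cont a j).continuousOn
  have K0 : 0 ≤ K := (norm_nonneg _).trans (hK 0 (by simp))
  refine ⟨K, K0, fun f hf => ?_⟩
  have hk := kq_cont a j
  have b1 : ‖∫ u in (0:ℝ)..a, f j u * kq a j u‖ ≤ ∫ u in (0:ℝ)..a, K * ‖f j u‖ := by
    refine (intervalIntegral.norm_integral_le_integral_norm h0).trans ?_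
    refine intervalIntegral.integral_mono_on h0 (Continuous.intervalIntegrable (by fun_prop) _ _)
      (Continuous.intervalIntegrable (by fun_prop) _ _) fun x hx => ?_
    rw [norm_mul, mul_comm]
    gcongr
    exact hK x ⟨by linarith [hx.1], by linarith [hx.2]⟩
  have b2 : ‖∫ u in a..(1:ℝ), f j u * kq a j (u-1)‖ ≤ ∫ u in a..(1:ℝ), K * ‖f j u‖ := by
    refine (intervalIntegral.norm_integral_le_integral_norm h1).trans ?_
    refine intervalIntegral.integral_mono_on h1 (Continuous.intervalIntegrable (by fun_prop) _ _)
      (Continuous.intervalIntegrable (by fun_prop) _ _) fun x hx => ?_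
    rw [norm_mul, mul_comm]
    gcongr
    exact hK (x-1) ⟨by linarith [hx.1], by linarith [hx.2]⟩
  rw [← intervalIntegral.integral_const_mul,
    ← intervalIntegral.integral_add_adjacent_intervals (b := a)
      (Continuous.intervalIntegrable (by fun_prop) _ _)
      (Continuous.intervalIntegrable (by fun_prop) _ _)]
  exact (norm_add_le _ _).trans (add_le_add b1 b2)

/-- the iterated derivatives of log (x + iy) -/
def fl (y : ℝ) (j : ℕ) (x : ℝ) : ℂ :=
  if j = 0 then Complex.log (x + y * I) else (-1)^(j-1) * (Nat.factorial (j-1)) * ((x + y * I)^j)⁻¹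

lemma xy_slit {y : ℝ} (hy : y ≠ 0) (x : ℝ) : (x + y * I : ℂ) ∈ Complex.slitPlane := by
  right; simpa using hy

lemma xy_deriv (y x : ℝ) : HasDerivAt (fun x : ℝ => (x + y * I : ℂ)) 1 x := by
  simpa using (Complex.ofRealCLM.hasDerivAt (x := x)).add_const ((y:ℂ) * I)

lemma fl_deriv {y : ℝ} (hy : y ≠ 0) (j : ℕ) (x : ℝ) : HasDerivAt (fl y j) (fl y (j+1) x) x := by
  have h0 := Complex.slitPlane_ne_zero (xy_slit hy x)
  unfold fl
  rcases j with _ | j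
  · simpa using (xy_deriv y x).clog_real (xy_slit hy x)
  · have := (((xy_deriv y x).pow (j+1)).inv (pow_ne_zero _ h0)).const_mul
      ((-1)^j * (Nat.factorial j : ℂ))
    simp only [Nat.add_sub_cancel, Nat.succ_ne_zero, if_false]
    refine HasDerivAt.congr_deriv this ?_
    rw [Nat.factorial_succ]
    simp only [Pi.pow_apply]
    push_cast
    field_simp
    ring

def FF (y : ℝ) (x : ℝ) : ℂ := (x + y * I) * Complex.log (x + y * I) - (x + y * I)

lemma FF_deriv {y : ℝ} (hy : y ≠ 0) (x : ℝ) : HasDerivAt (FF y) (fl y 0 x) x := by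
  have h0 := Complex.slitPlane_ne_zero (xy_slit hy x)
  have := ((xy_deriv y x).mul ((xy_deriv y x).clog_real (xy_slit hy x))).sub (xy_deriv y x)
  refine HasDerivAt.congr_deriv this ?_
  simp only [fl, if_true]
  field_simp
  simp

lemma EMsum {y : ℝ} (hy : y ≠ 0) (a : ℝ) (M m : ℕ) :
    ∑ k ∈ Finset.range m, fl y 0 (k + a) = FF y m - FF y 0 +
      (∑ j ∈ Finset.range (M+1), kq a (j+1) 0 * (fl y j m - fl y j 0))
      - ∑ k ∈ Finset.range m, RR a (fun j u => fl y j (k + u)) (M+1) := by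
  induction m with
  | zero => simp
  | succ m ih =>
    have h := EM1 a (fun j u => fl y j (m + u)) (fun j x => by
      simpa using (fl_deriv hy j (m+x)).comp_const_add (m:ℝ) x) M
    have h2 : (∫ u in (0:ℝ)..1, fl y 0 (m+u)) = FF y (m+1) - FF y m := by
      have := intervalIntegral.integral_eq_sub_of_hasDerivAt (a := 0) (b := 1)
        (f := fun u => FF y (m+u)) (f' := fun u => fl y 0 (m+u))
        (fun x _ => by simpa using (FF_deriv hy (m+x)).comp_const_add (m:ℝ) x)
        (Continuous.intervalIntegrable (by
          have : Continuous (fl y 0) :=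
            continuous_iff_continuousAt.2 fun x => (fl_deriv hy 0 x).continuousAt
          fun_prop) _ _)
      simpa using this
    rw [Finset.sum_range_succ, ih, Finset.sum_range_succ (fun k : ℕ => RR a (fun j u => fl y j (k + u)) (M+1))]
    simp only [h2, add_zero] at h
    push_cast
    simp only [mul_sub, Finset.sum_sub_distrib] at h ⊢
    linear_combination -h

lemma RR_total (N : ℕ) (hN : 1 ≤ N) (a : ℝ) (h0 : 0 ≤ a) (h1 : a ≤ 1) : ∃ K : ℝ, ∀ (y : ℝ), y ≠ 0 →
    ∀ m : ℕ, ‖∑ k ∈ Finset.range m, RR a (fun j u => fl y j (k + u)) (2*N)‖ ≤ K / |y|^(2*N-1) := by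
  obtain ⟨K, K0, hK⟩ := RR_bound a h0 h1 (2*N)
  refine ⟨K * (Nat.factorial (2*N-1)) * (π/2), fun y hy m => ?_⟩
  have hy' : 0 < |y| := abs_pos.2 hy
  set D : ℝ := (Nat.factorial (2*N-1)) / |y|^(2*N-2) with hD
  have D0 : 0 ≤ D := by positivity
  have hH : ∀ x : ℝ, HasDerivAt (fun x => Real.arctan (x/|y|) / |y|) (1/(x^2+y^2)) x := by
    intro x
    have := (((hasDerivAt_id x).div_const |y|).arctan).div_const |y|
    refine HasDerivAt.congr_deriv this ?_
    have : x^2+y^2 ≠ 0 := by positivity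
    have : 1 + (x/|y|)^2 ≠ 0 := by positivity
    simp only [id]
    rw [div_pow, sq_abs, mul_div_assoc, div_div, abs_mul_abs_self, one_div_mul_one_div]
    congr 1
    field_simp
    ring
  have hcc : Continuous fun x : ℝ => 1/(x^2+y^2) := by
    apply Continuous.div (by fun_prop) (by fun_prop)
    intro x; positivity
  have hcc2 : ∀ k : ℝ, Continuous fun x : ℝ => 1/((k+x)^2+y^2) := fun k =>
    hcc.comp (by fun_prop : Continuous fun x : ℝ => k + x)
  have hfc : Continuous (fl y (2*N)) :=
    continuous_iff_continuousAt.2 fun x => (fl_deriv hy (2*N) x).continuousAt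
  have hb : ∀ x : ℝ, ‖fl y (2*N) x‖ ≤ D * (1/(x^2+y^2)) := by
    intro x
    have hn : ‖(x + y * I : ℂ)‖^2 = x^2+y^2 := by
      rw [← Complex.normSq_eq_norm_sq, Complex.normSq_add_mul_I]
    have hN2 : 2*N ≠ 0 := by omega
    simp only [fl, hN2, if_false, norm_mul, norm_pow, norm_neg, norm_one, one_pow, one_mul,
      norm_inv, Complex.norm_natCast]
    rw [pow_mul, hn, hD]
    obtain ⟨n, rfl⟩ : ∃ n, N = n+1 := ⟨N-1, by omega⟩
    rw [pow_succ, show 2*(n+1)-2 = 2*n by omega, pow_mul, sq_abs, mul_inv, one_div, div_eq_mul_inv,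
      mul_assoc]
    gcongr
    nlinarith [sq_nonneg x]
  have hk : ∀ k : ℕ, ‖RR a (fun j u => fl y j (k + u)) (2*N)‖ ≤
      K * (D * (Real.arctan (((k+1:ℕ):ℝ)/|y|) / |y| - Real.arctan ((k:ℝ)/|y|) / |y|)) := by
    intro k
    refine (hK _ (by fun_prop)).trans ?_
    gcongr
    have := intervalIntegral.integral_eq_sub_of_hasDerivAt (a := (0:ℝ)) (b := 1)
        (f := fun u => Real.arctan ((k+u)/|y|) / |y|) (f' := fun u => 1/((k+u)^2+y^2))
        (fun x _ => by simpa using (hH (k+x)).comp_const_add (k:ℝ) x)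
        (Continuous.intervalIntegrable (hcc2 _) _ _)
    push_cast
    simp only [add_zero] at this
    rw [← this, ← intervalIntegral.integral_const_mul]
    refine intervalIntegral.integral_mono_on zero_le_one
      (Continuous.intervalIntegrable (by fun_prop) _ _)
      (Continuous.intervalIntegrable ((hcc2 _).const_mul _) _ _) fun x hx => hb _
  refine (norm_sum_le _ _).trans ((Finset.sum_le_sum fun k _ => hk k).trans ?_)
  rw [← Finset.mul_sum, ← Finset.mul_sum,
    Finset.sum_range_sub (fun k : ℕ => Real.arctan ((k:ℝ)/|y|) / |y|)]
  simp only [Nat.cast_zero, zero_div, Real.arctan_zero, sub_zero]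
  have : K * (Nat.factorial (2*N-1)) * (π/2) / |y|^(2*N-1) = K * (D * ((π/2)/|y|)) := by
    rw [hD, show 2*N-1 = (2*N-2)+1 by omega, pow_succ]
    field_simp
  rw [this]
  gcongr
  exact (Real.arctan_lt_pi_div_two _).le

lemma im_log_eq {x : ℝ} (hx : 0 < x) (y : ℝ) :
    (Complex.log (x + y * I)).im = Real.arctan (y / x) := by
  rw [Complex.log_im]
  have h := Complex.abs_arg_lt_pi_div_two_iff.2 (Or.inl (by simpa using hx) : 0 < (x + y * I : ℂ).re ∨ (x + y * I : ℂ) = 0)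
  rw [abs_lt] at h
  rw [← Real.arctan_tan h.1 h.2, Complex.tan_arg]
  simp

lemma arctan_sub_le (v : ℝ) : |v - Real.arctan v| ≤ |v|^3 := by
  have h := (convex_Icc (-|v|) |v|).norm_image_sub_le_of_norm_hasDerivWithin_le
    (f := fun v => v - Real.arctan v) (f' := fun v => 1 - 1/(1+v^2)) (C := v^2) (x := 0) (y := v)
    (fun x _ => ((hasDerivAt_id x).sub (Real.hasDerivAt_arctan x)).hasDerivWithinAt)
    (fun x hx => by
      have hx2 : x^2 ≤ v^2 := sq_le_sq.2 (abs_le.2 hx)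
      have : 1 - 1/(1+x^2) = x^2/(1+x^2) := by field_simp; ring
      rw [this, Real.norm_of_nonneg (by positivity)]
      refine (div_le_self (by positivity) (by nlinarith [sq_nonneg x])).trans hx2)
    (by simp) ⟨neg_abs_le v, le_abs_self v⟩
  simp only [Real.arctan_zero, sub_zero, Real.norm_eq_abs] at h
  rwa [← sq_abs, ← pow_succ] at h

def uu (k : ℕ) (y : ℝ) : ℝ :=
  y * (Real.log ((k:ℝ)+1) - Real.log k) - Real.arctan (y / (k + 1/4))

def BB (y : ℝ) (m : ℕ) : ℝ :=
  y * Real.log m - ∑ k ∈ Finset.range m, Real.arctan (y / (k + 1/4))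

lemma BB_eq (y : ℝ) (m : ℕ) : BB y m = ∑ k ∈ Finset.range m, uu k y := by
  unfold BB uu
  rw [Finset.sum_sub_distrib, ← Finset.mul_sum]
  have := Finset.sum_range_sub (fun k : ℕ => Real.log k) m
  push_cast at this
  rw [this]; simp

lemma uu_bound (Y y : ℝ) (hy : |y| ≤ Y) (k : ℕ) :
    ‖uu k y‖ ≤ (Y + Y^3) * (1/(k:ℝ)^2) + if k = 0 then π else 0 := by
  have Y0 : 0 ≤ Y := (abs_nonneg y).trans hy
  rcases Nat.eq_zero_or_pos k with rfl | hk
  · simp only [uu]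
    simp
    rw [abs_le]
    constructor <;> linarith [Real.arctan_lt_pi_div_two (y*4), Real.neg_pi_div_two_lt_arctan (y*4),
      Real.pi_pos]
  · have k1 : (1:ℝ) ≤ k := by exact_mod_cast hk
    have k0 : (0:ℝ) < k := by linarith
    rw [if_neg (by omega), add_zero]
    have l : Real.log ((k:ℝ)+1) - Real.log k = Real.log (1 + 1/k) := by
      rw [← Real.log_div (by positivity) (by positivity)]
      congr 1; field_simp
    have l1 : Real.log (1 + 1/(k:ℝ)) ≤ 1/k := by
      have := Real.log_le_sub_one_of_pos (x := 1 + 1/(k:ℝ)) (by positivity)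
      linarith
    have l2 : 1/((k:ℝ)+1) ≤ Real.log (1 + 1/k) := by
      have := Real.one_sub_inv_le_log_of_pos (x := 1 + 1/(k:ℝ)) (by positivity)
      refine le_trans (le_of_eq ?_) this
      field_simp; ring
    have c1 : 1/((k:ℝ)+1/4) ≤ 1/k := by gcongr; linarith
    have c2 : 1/((k:ℝ)+1) ≤ 1/(k+1/4) := by gcongr; norm_num
    have c3 : 1/(k:ℝ) - 1/(k+1) ≤ 1/(k:ℝ)^2 := by
      rw [div_sub_div _ _ (by positivity) (by positivity), div_le_div_iff₀ (by positivity) (by positivity)]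
      nlinarith
    have c4 : |Real.log (1+1/(k:ℝ)) - 1/(k+1/4)| ≤ 1/(k:ℝ)^2 := by
      rw [abs_le]; constructor <;> linarith
    have c5 := arctan_sub_le (y / (k+1/4))
    have c6 : |y/((k:ℝ)+1/4)|^3 ≤ Y^3 * (1/(k:ℝ)^2) := by
      rw [abs_div, div_pow, abs_of_pos (by positivity : (0:ℝ) < k+1/4), mul_one_div]
      gcongr
      calc (k:ℝ)^2 ≤ k^3 := pow_le_pow_right₀ k1 (by norm_num)
        _ ≤ _ := by gcongr; linarith
    have e : uu k y = y * (Real.log (1+1/(k:ℝ)) - 1/(k+1/4)) +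
        (y/(k+1/4) - Real.arctan (y / (k+1/4))) := by
      unfold uu; rw [l]; ring
    rw [e, add_mul]
    refine (norm_add_le _ _).trans (add_le_add ?_ (c5.trans c6))
    rw [norm_mul]
    exact mul_le_mul hy c4 (norm_nonneg _) Y0

lemma bound_summable (Y : ℝ) :
    Summable fun k : ℕ => (Y + Y^3) * (1/(k:ℝ)^2) + if k = 0 then π else 0 :=
  ((Real.summable_one_div_nat_pow.2 (by norm_num)).mul_left _).add (hasSum_ite_eq 0 π).summable

def AA (y : ℝ) : ℝ := ∑' k, uu k y

lemma AA_cont : Continuous AA := by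
  rw [continuous_iff_continuousAt]
  intro x
  have : ContinuousOn AA (Metric.ball 0 (|x|+1)) := by
    refine continuousOn_tsum (fun k => ?_) (bound_summable (|x|+1)) (fun k y hy => ?_)
    · apply Continuous.continuousOn
      unfold uu
      fun_prop
    · apply uu_bound
      simpa using (Metric.mem_ball.1 hy).le
  exact this.continuousAt (Metric.isOpen_ball.mem_nhds (by simp))

lemma AA_zero : AA 0 = 0 := by simp [AA, uu]

lemma BB_tendsto (y : ℝ) : Filter.Tendsto (BB y) Filter.atTop (nhds (AA y)) := by
  have : Summable fun k => uu k y :=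
    Summable.of_norm_bounded (bound_summable |y|) (fun k => uu_bound _ _ le_rfl k)
  have h := this.hasSum.tendsto_sum_nat
  exact h.congr fun m => (BB_eq y m).symm

lemma GammaSeq_polar (y : ℝ) (n : ℕ) (hn : 1 ≤ n) : Complex.GammaSeq ((1/4:ℝ) + y * I) n =
    ‖Complex.GammaSeq ((1/4:ℝ) + y * I) n‖ *
      Complex.exp (((y * Real.log n - ∑ k ∈ Finset.range (n+1), Real.arctan (y / (k + 1/4)) : ℝ) : ℂ) * I) := by
  have hn0 : (n:ℂ) ≠ 0 := by exact_mod_cast (by omega : n ≠ 0)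
  have hk : ∀ k : ℕ, ((1/4:ℝ) + y * I + k : ℂ) = ‖((1/4:ℝ) + y * I + k : ℂ)‖ *
      Complex.exp ((Real.arctan (y / (k + 1/4)) : ℂ) * I) := by
    intro k
    have h := Complex.norm_mul_exp_arg_mul_I ((1/4:ℝ) + y * I + k : ℂ)
    have e : ((1/4:ℝ) + y * I + k : ℂ) = (((k:ℝ)+1/4 : ℝ) : ℂ) + y * I := by push_cast; ring
    have h2 := im_log_eq (x := (k:ℝ)+1/4) (by positivity) y
    rw [Complex.log_im, ← e] at h2
    rw [h2] at h
    exact h.symm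
  have h1 : (n:ℂ)^((1/4:ℝ) + y * I : ℂ) = ‖(n:ℂ)^((1/4:ℝ) + y * I : ℂ)‖ *
      Complex.exp ((y * Real.log n : ℝ) * I) := by
    rw [Complex.cpow_def_of_ne_zero hn0, Complex.norm_exp, Complex.ofReal_exp, ← Complex.exp_add]
    congr 1
    have him : (Complex.log (n:ℂ)).im = 0 := by rw [← Complex.natCast_log, Complex.ofReal_im]
    apply Complex.ext <;> simp [mul_comm, him]
  have h2 : (∏ j ∈ Finset.range (n+1), ((1/4:ℝ) + y * I + j : ℂ)) =
     ‖∏ j ∈ Finset.range (n+1), ((1/4:ℝ) + y * I + j : ℂ)‖ *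
      Complex.exp ((∑ k ∈ Finset.range (n+1), Real.arctan (y / (k + 1/4)) : ℝ) * I) := by
    rw [norm_prod]
    push_cast
    rw [Finset.sum_mul, Complex.exp_sum, ← Finset.prod_mul_distrib]
    refine Finset.prod_congr rfl fun k _ => ?_
    have := hk k
    push_cast at this
    exact this
  unfold Complex.GammaSeq
  rw [norm_div, norm_mul, Complex.norm_natCast]
  generalize (∏ j ∈ Finset.range (n+1), ((1/4:ℝ) + y * I + j : ℂ)) = P at *
  generalize (n:ℂ)^((1/4:ℝ) + y * I : ℂ) = Q at *
  conv_lhs => rw [h1, h2]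
  rw [Complex.ofReal_sub, sub_mul, Complex.exp_sub]
  push_cast
  ring

lemma Gamma_polar (y : ℝ) : Complex.Gamma ((1/4:ℝ) + y * I) =
    ‖Complex.Gamma ((1/4:ℝ) + y * I)‖ * Complex.exp ((AA y : ℂ) * I) := by
  have h := Complex.GammaSeq_tendsto_Gamma ((1/4:ℝ) + y * I)
  have hb : Filter.Tendsto (fun n : ℕ => y * Real.log n -
      ∑ k ∈ Finset.range (n+1), Real.arctan (y / (k + 1/4))) Filter.atTop (nhds (AA y)) := by
    have h1 := ((BB_tendsto y).comp (Filter.tendsto_add_atTop_nat 1)).sub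
      ((Real.tendsto_log_nat_add_one_sub_log).const_mul y)
    simp only [mul_zero, sub_zero] at h1
    refine h1.congr fun n => ?_
    simp [BB]
    ring
  have h2 := (Complex.continuous_ofReal.tendsto _ |>.comp h.norm).mul
    ((Complex.continuous_exp.tendsto _).comp
      (((Complex.continuous_ofReal.tendsto _).comp hb).mul_const I))
  refine tendsto_nhds_unique h (h2.congr' ?_)
  filter_upwards [Filter.eventually_ge_atTop 1] with n hn
  exact (GammaSeq_polar y n hn).symm

lemma chi_half (t : ℝ) : chi (1/2 + I * t) =
    Complex.exp (-2 * I * ((AA (t/2) - t/2 * Real.log π : ℝ) : ℂ)) := by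
  have hpi : (π:ℂ) ≠ 0 := by exact_mod_cast Real.pi_ne_zero
  have hG := Gamma_polar (t/2)
  have e1 : (1/2 + I * t : ℂ)/2 = ((1/4:ℝ) : ℂ) + ((t/2:ℝ):ℂ) * I := by push_cast; ring
  have e2 : (1 - (1/2 + I * t : ℂ))/2 = (starRingEnd ℂ) (((1/4:ℝ) : ℂ) + ((t/2:ℝ):ℂ) * I) := by
    rw [map_add, map_mul, Complex.conj_ofReal, Complex.conj_ofReal, Complex.conj_I]
    push_cast; ring
  have hne : Complex.Gamma (((1/4:ℝ) : ℂ) + ((t/2:ℝ):ℂ) * I) ≠ 0 := by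
    apply Complex.Gamma_ne_zero_of_re_pos
    simp
  unfold chi
  rw [e1, e2, Complex.Gamma_conj, hG]
  set r : ℝ := ‖Complex.Gamma (((1/4:ℝ) : ℂ) + ((t/2:ℝ):ℂ) * I)‖ with hr
  have hr0 : (r:ℂ) ≠ 0 := by
    exact_mod_cast norm_ne_zero_iff.2 hne
  rw [map_mul, Complex.conj_ofReal, ← Complex.exp_conj, map_mul, Complex.conj_ofReal, Complex.conj_I,
    mul_div_assoc, mul_div_mul_left _ _ hr0, ← Complex.exp_sub,
    Complex.cpow_def_of_ne_zero hpi, ← Complex.exp_add, ← Complex.ofReal_log Real.pi_pos.le]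
  congr 1
  push_cast
  ring

lemma theta_eq (ϑ : ℂ → ℂ) (hϑ : IsRSTheta ϑ) (t : ℝ) :
    ϑ (1/2 + I * t) = ((AA (t/2) - t/2 * Real.log π : ℝ) : ℂ) := by
  obtain ⟨hd, he, h0⟩ := hϑ
  have hmem : ∀ t : ℝ, (1/2 + I * t : ℂ) ∈ RSOmega := fun t => by
    right; constructor <;> simp <;> norm_num
  have hopen : IsOpen RSOmega := by
    unfold RSOmega
    have : {s : ℂ | s.im ≠ 0 ∨ (0 < s.re ∧ s.re < 1)} =
      {s : ℂ | s.im ≠ 0} ∪ ({s | 0 < s.re} ∩ {s | s.re < 1}) := rfl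
    rw [this]
    exact (isOpen_ne_fun Complex.continuous_im continuous_const).union
      ((isOpen_lt continuous_const Complex.continuous_re).inter
        (isOpen_lt Complex.continuous_re continuous_const))
  have hc : Continuous fun t : ℝ => ϑ (1/2 + I * t) := by
    rw [continuous_iff_continuousAt]
    intro t
    have h1 : ContinuousAt ϑ (1/2 + I * t) :=
      (hd.differentiableAt (hopen.mem_nhds (hmem t))).continuousAt
    exact ContinuousAt.comp (f := fun t : ℝ => (1/2 + I * t : ℂ)) h1 (by fun_prop)
  have hA := AA_cont
  have hex : ∀ t : ℝ, ∃ n : ℤ, ϑ (1/2 + I * t) - ((AA (t/2) - t/2 * Real.log π : ℝ) : ℂ) = n * π := by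
    intro t
    have h := he _ (hmem t)
    rw [chi_half, Complex.exp_eq_exp_iff_exists_int] at h
    obtain ⟨n, hn⟩ := h
    refine ⟨-n, ?_⟩
    have hI : (-2 * I) ≠ 0 := by simp
    apply mul_left_cancel₀ hI
    push_cast at hn ⊢
    linear_combination hn
  choose n hn using hex
  have hnc : Continuous n := by
    rw [Int.isClosedEmbedding_coe_real.isEmbedding.continuous_iff]
    have : ((fun m : ℤ => (m:ℝ)) ∘ n) = fun t : ℝ => (ϑ (1/2 + I * t) - ((AA (t/2) - t/2 * Real.log π : ℝ) : ℂ)).re / π := by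
      funext t
      rw [hn t]
      simp
    rw [this]
    have hA2 : Continuous fun t : ℝ => AA (t/2) := hA.comp (by fun_prop)
    exact (Complex.continuous_re.comp (hc.sub (Complex.continuous_ofReal.comp
      (hA2.sub (by fun_prop))))).div_const _
  have h1 := PreconnectedSpace.constant inferInstance hnc (x := t) (y := 0)
  have h2 := hn 0
  simp [AA_zero] at h2
  have h3 : (1/2 : ℂ) = 2⁻¹ := by norm_num
  rw [h3] at h0
  rw [h0] at h2
  have h4 := hn t
  rw [h1] at h4
  rcases (zero_eq_mul.1 h2) with h | h
  · rw [h, zero_mul, sub_eq_zero] at h4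
    exact h4
  · exact absurd h (by exact_mod_cast Real.pi_ne_zero)

lemma FF_tendsto (y : ℝ) : Filter.Tendsto (fun m : ℕ => y * Real.log m - (FF y m).im)
    Filter.atTop (nhds 0) := by
  have h1 : Filter.Tendsto (fun m : ℕ => (m:ℂ) * (y * I / m)) Filter.atTop (nhds (y * I)) := by
    refine tendsto_const_nhds.congr' ?_
    filter_upwards [Filter.eventually_ge_atTop 1] with m hm
    have : (m:ℂ) ≠ 0 := by exact_mod_cast (by omega : m ≠ 0)
    field_simp
  have h2 := Complex.tendsto_nat_mul_log_one_add_of_tendsto h1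
  have h3 : Filter.Tendsto (fun m : ℕ => (1 + y * I / m : ℂ)) Filter.atTop (nhds 1) := by
    simpa using (tendsto_const_div_atTop_nhds_zero_nat ((y:ℂ) * I)).const_add 1
  have h4 : Filter.Tendsto (fun m : ℕ => Complex.log (1 + y * I / m : ℂ)) Filter.atTop (nhds 0) := by
    simpa using h3.clog (by simp)
  have h5 := (Complex.continuous_im.tendsto _).comp
    (((h2.add (h4.const_mul ((y:ℂ)*I))).sub_const ((y:ℂ)*I)).neg)
  simp only [mul_zero, add_zero, sub_self, neg_zero, Complex.zero_im] at h5
  refine h5.congr' ?_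
  filter_upwards [Filter.eventually_ge_atTop 1] with m hm
  have hm0 : (m:ℂ) ≠ 0 := by exact_mod_cast (by omega : m ≠ 0)
  have hmr : (0:ℝ) < m := by exact_mod_cast hm
  have hne : (1 + y * I / m : ℂ) ≠ 0 := by
    intro h
    have := congrArg Complex.re h
    have e : (y * I / m : ℂ) = ((y / m : ℝ) : ℂ) * I := by push_cast; ring
    rw [e] at this
    simp at this
  have e : ((m:ℝ) + y * I : ℂ) = ((m:ℝ):ℂ) * (1 + y * I / m) := by
    push_cast; field_simp
  have hl : Complex.log ((m:ℝ) + y * I : ℂ) = Real.log m + Complex.log (1 + y * I / m) := by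
    rw [e, Complex.log_ofReal_mul hmr hne]
  have : FF y m = (m * Complex.log (1 + y * I / m) + y * I * Complex.log (1 + y * I / m) - y * I)
      + ((m * Real.log m - m : ℝ) : ℂ) + ((y * Real.log m : ℝ) : ℂ) * I := by
    unfold FF
    rw [hl]
    push_cast; ring
  rw [this]
  simp only [Function.comp, Complex.neg_im, Complex.add_im, Complex.ofReal_im,
    Complex.im_ofReal_mul, Complex.I_im]
  ring

lemma fl_tendsto (y : ℝ) (j : ℕ) : Filter.Tendsto (fun m : ℕ => (fl y j m).im)
    Filter.atTop (nhds 0) := by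
  rcases j with _ | j
  · have h : Filter.Tendsto (fun m : ℕ => Real.arctan (y/m)) Filter.atTop (nhds 0) := by
      have := (Real.continuous_arctan.tendsto 0).comp (tendsto_const_div_atTop_nhds_zero_nat y)
      simpa [Function.comp_def] using this
    refine h.congr' ?_
    filter_upwards [Filter.eventually_ge_atTop 1] with m hm
    simp only [fl, if_true]
    exact (im_log_eq (by exact_mod_cast hm) y).symm
  · have h1 : Filter.Tendsto (fun m : ℕ => (((m:ℝ) + y * I : ℂ))⁻¹) Filter.atTop (nhds 0) := by
      rw [tendsto_zero_iff_norm_tendsto_zero]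
      refine squeeze_zero' (Filter.Eventually.of_forall fun _ => norm_nonneg _) ?_
        (tendsto_inv_atTop_nhds_zero_nat (𝕜 := ℝ))
      filter_upwards [Filter.eventually_ge_atTop 1] with m hm
      have hmr : (0:ℝ) < m := by exact_mod_cast hm
      rw [norm_inv]
      gcongr
      have := Complex.abs_re_le_norm ((m:ℝ) + y * I : ℂ)
      simpa using this
    have h2 := (h1.pow (j+1)).const_mul ((-1:ℂ)^j * (Nat.factorial j))
    have h3 := (Complex.continuous_im.tendsto _).comp h2
    simp at h3
    refine h3.congr fun m => ?_
    simp [fl]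

lemma AA_asymp (N : ℕ) (hN : 1 ≤ N) : ∃ K : ℝ, ∀ y : ℝ, y ≠ 0 →
    |AA y - ((FF y 0).im + ∑ j ∈ Finset.range (2*N),
      bernoulliFun (j+1) (1/4) / (Nat.factorial (j+1)) * (fl y j 0).im)| ≤ K / |y|^(2*N-1) := by
  obtain ⟨K, hK⟩ := RR_total N hN (1/4) (by norm_num) (by norm_num)
  refine ⟨K, fun y hy => ?_⟩
  set X : ℝ := (FF y 0).im + ∑ j ∈ Finset.range (2*N),
      bernoulliFun (j+1) (1/4) / (Nat.factorial (j+1)) * (fl y j 0).im with hX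
  have hl : Filter.Tendsto (fun m : ℕ => |BB y m - X - (y * Real.log m - (FF y m).im) +
      ∑ j ∈ Finset.range (2*N), bernoulliFun (j+1) (1/4) / (Nat.factorial (j+1)) * (fl y j m).im|)
      Filter.atTop (nhds |AA y - X|) := by
    have := ((((BB_tendsto y).sub_const X).sub (FF_tendsto y)).add
      (tendsto_finsetSum (Finset.range (2*N)) fun j _ => (fl_tendsto y j).const_mul
        (bernoulliFun (j+1) (1/4) / (Nat.factorial (j+1))))).abs
    simpa using this
  refine le_of_tendsto' hl fun m => ?_
  refine le_trans (le_of_eq ?_) ((Complex.abs_im_le_norm _).trans (hK y hy m))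
  congr 1
  have h := congrArg Complex.im (EMsum hy (1/4) (2*N-1) m)
  rw [show 2*N-1+1 = 2*N by omega] at h
  simp only [Complex.sub_im, Complex.add_im, Complex.im_sum, kq, Complex.im_ofReal_mul, sub_zero,
    mul_sub, Finset.sum_sub_distrib] at h
  have h2 : ∑ k ∈ Finset.range m, (fl y 0 (k + 1/4)).im =
      ∑ k ∈ Finset.range m, Real.arctan (y / (k + 1/4)) :=
    Finset.sum_congr rfl fun k _ => by
      simp only [fl, if_true]
      exact im_log_eq (by positivity) y
  rw [h2] at h
  rw [BB, hX, Complex.im_sum]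
  linear_combination -h

def TT (t : ℝ) (n : ℕ) : ℝ :=
  (-4:ℝ)^(n-1) * (Polynomial.aeval ((1:ℝ)/4) (Polynomial.bernoulli (2*n))) /
                ((2*(n:ℝ)-1)*(n:ℝ)*t^(2*n-1))

lemma fl_even {y : ℝ} (n : ℕ) : (fl y (2*n+2) 0).im = 0 := by
  have : fl y (2*n+2) 0 = (((-1)^(2*n+1) * (Nat.factorial (2*n+1)) * ((-1)^(n+1) * y^(2*n+2))⁻¹ : ℝ) : ℂ) := by
    simp only [fl, Nat.succ_ne_zero, if_false]
    rw [Complex.ofReal_zero, zero_add, mul_pow, show 2*n+2 = 2*(n+1) by ring, pow_mul I, Complex.I_sq,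
      show 2*(n+1)-1 = 2*n+1 by omega]
    push_cast
    ring
  rw [this, Complex.ofReal_im]

lemma fl_odd {y : ℝ} (n : ℕ) : (fl y (2*n+1) 0).im =
    -((-1)^n * (Nat.factorial (2*n)) / y^(2*n+1)) := by
  have : fl y (2*n+1) 0 = ((-((-1)^n * (Nat.factorial (2*n)) / y^(2*n+1)) : ℝ) : ℂ) * I := by
    simp only [fl, Nat.succ_ne_zero, if_false, Nat.add_sub_cancel]
    have e : (((-1:ℂ)^n))⁻¹ = (-1)^n := by
      rcases neg_one_pow_eq_or ℂ n with h | h <;> rw [h] <;> norm_num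
    rw [Complex.ofReal_zero, zero_add, mul_pow, pow_succ I, pow_mul I, Complex.I_sq, mul_inv, mul_inv,
      Complex.inv_I, e, pow_mul (-1:ℂ) 2 n]
    push_cast
    simp
    ring
  rw [this, Complex.im_ofReal_mul, Complex.I_im, mul_one]

lemma term_odd (t : ℝ) (n : ℕ) :
    bernoulliFun (2*n+1+1) (1/4) / (Nat.factorial (2*n+1+1)) * (fl (t/2) (2*n+1) 0).im = -TT t (n+1) := by
  rw [fl_odd, TT, bernoulliFun, Polynomial.eval_map_algebraMap, show 2*(n+1) = 2*n+1+1 by ring]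
  generalize (Polynomial.aeval ((1:ℝ)/4)) (Polynomial.bernoulli (2*n+1+1)) = B
  have hf : (Nat.factorial (2*n) : ℝ) ≠ 0 := by positivity
  have h4 : (-4:ℝ)^n = (-1)^n * 2^(2*n) := by
    rw [pow_mul, ← mul_pow]; norm_num
  rw [Nat.factorial_succ, Nat.factorial_succ, div_pow]
  simp only [Nat.add_sub_cancel]
  rw [h4]
  push_cast
  by_cases ht : t = 0
  · simp [ht]
  · have h1 : (2*((n:ℝ)+1)-1) = 2*n+1 := by ring
    rw [h1]
    field_simp
    ring

lemma sum_eq {t : ℝ} (ht : t ≠ 0) (n : ℕ) : ∑ j ∈ Finset.range (2*(n+1)),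
      bernoulliFun (j+1) (1/4) / (Nat.factorial (j+1)) * (fl (t/2) j 0).im =
    -(Real.sign t * π/8) - ∑ n ∈ Finset.Icc 1 (n+1), TT t n := by
  induction n with
  | zero =>
    have h := term_odd t 0
    have h0 : (fl (t/2) 0 0).im = Real.sign t * (π/2) := by
      simp only [fl, if_true, Complex.log_im, Complex.ofReal_zero, zero_add]
      rcases lt_or_gt_of_ne ht with h | h
      · rw [Real.sign_of_neg h, Complex.arg_eq_neg_pi_div_two_iff.2]
        · ring
        · constructor
          · simp
          · simp; linarith
      · rw [Real.sign_of_pos h, Complex.arg_eq_pi_div_two_iff.2]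
        · ring
        · constructor <;> simp [h]
    simp only [mul_zero, zero_add] at h
    rw [show 2*(0+1) = 1+1 by norm_num, Finset.sum_range_succ, Finset.sum_range_one]
    simp only [zero_add, Finset.Icc_self, Finset.sum_singleton]
    rw [h, h0, bernoulliFun_one]
    simp
    ring
  | succ n ih =>
    rw [show 2*(n+1+1) = 2*(n+1)+1+1 by ring, Finset.sum_range_succ, Finset.sum_range_succ, ih,
      term_odd, show 2*(n+1) = 2*n+2 by ring, fl_even,
      Finset.sum_Icc_succ_top (b := n+1) (by omega)]
    ring

lemma FF_zero_im {y : ℝ} : (FF y 0).im = y * Real.log |y| - y := by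
  simp [FF, Complex.log_re]

theorem statement17 (N : ℕ) (hN : 1 ≤ N) (ϑ : ℂ → ℂ) (hϑ : IsRSTheta ϑ) :
    ∃ C : ℝ, ∀ t : ℝ, t ≠ 0 →
      ‖ϑ (1/2 + I*(t:ℂ)) - ((t/2 * Real.log (|t|/(2*π)) : ℝ) : ℂ) + ((t/2 : ℝ) : ℂ)
          + ((Real.sign t * π/8 : ℝ) : ℂ)
          + ((∑ n ∈ Finset.Icc 1 (N-1),
              (-4:ℝ)^(n-1) * (Polynomial.aeval ((1:ℝ)/4) (Polynomial.bernoulli (2*n))) /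
                ((2*(n:ℝ)-1)*(n:ℝ)*t^(2*n-1)) : ℝ) : ℂ)‖
        ≤ C / |t|^(2*N-1) := by
  obtain ⟨K, hK⟩ := AA_asymp N hN
  obtain ⟨n, rfl⟩ : ∃ n, N = n+1 := ⟨N-1, by omega⟩
  refine ⟨K * 2^(2*(n+1)-1) + |TT 1 (n+1)|, fun t ht => ?_⟩
  have h := hK (t/2) (by simpa using ht)
  have ht' : 0 < |t| := abs_pos.2 ht
  rw [sum_eq ht, FF_zero_im, Finset.sum_Icc_succ_top (by omega)] at h
  have hl : Real.log |t/2| = Real.log (|t|/(2*π)) + Real.log π := by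
    rw [← Real.log_mul (by positivity) (by positivity), abs_div, abs_two]
    congr 1
    field_simp
  have hT : |TT t (n+1)| = |TT 1 (n+1)| / |t|^(2*(n+1)-1) := by
    rw [← abs_pow, ← abs_div]
    congr 1
    unfold TT
    rw [one_pow, mul_one, div_div]
  have hKK : K / |t/2|^(2*(n+1)-1) = K * 2^(2*(n+1)-1) / |t|^(2*(n+1)-1) := by
    rw [abs_div, abs_two, div_pow, div_div_eq_mul_div]
  rw [theta_eq ϑ hϑ t, ← Complex.ofReal_sub, ← Complex.ofReal_add, ← Complex.ofReal_add,
    ← Complex.ofReal_add, Complex.norm_real, Real.norm_eq_abs, add_div, ← hT, ← hKK]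
  refine le_trans ?_ (add_le_add_left h _)
  rw [hl]
  refine le_trans (le_of_eq ?_) (abs_sub _ _)
  congr 1
  rw [Nat.add_sub_cancel]
  change _ + ∑ n ∈ Finset.Icc 1 n, TT t n = _
  ring


end
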